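/- arXiv:1406.7330 — 7 statements merged into one kernel-verified Lean document; each statement's English description precedes it below -/
import Mathlib

section
/- Let n ≥ 1, let v ∈ ℝⁿ, let λ ≥ 0, μ ≥ 0 and ρ > 0, and define F(u) = λ‖u‖₂ + μ‖u‖₁ + (ρ/2)‖u − v‖₂². Define w ∈ ℝⁿ componentwise by wᵢ = ρ · sgn(vᵢ) · max(|vᵢ| − μ/ρ, 0). Then the vector u* = (max(‖w‖₂ − λ, 0) / (ρ‖w‖₂)) · w (interpreted as u* = 0 when w = 0) is a global minimizer of F over ℝⁿ, i.e., F(u*) ≤ F(u) for all u ∈ ℝⁿ. -/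
open Finset

/-- Euclidean norm on ℝⁿ. -/
noncomputable def norm2 {n : ℕ} (u : Fin n → ℝ) : ℝ := Real.sqrt (∑ i, (u i) ^ 2)

/-- ℓ¹ norm on ℝⁿ. -/
noncomputable def norm1 {n : ℕ} (u : Fin n → ℝ) : ℝ := ∑ i, |u i|

/-- Lemma 1 of the paper: closed-form proximal operator of the sparse group
lasso penalty.  The vector `u* = (max(‖w‖₂ − λ, 0) / (ρ‖w‖₂)) · w` is a global
minimizer of `F(u) = λ‖u‖₂ + μ‖u‖₁ + (ρ/2)‖u − v‖₂²`. -/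
theorem stmt0 (n : ℕ) (hn : 1 ≤ n) (v : Fin n → ℝ) (lam mu rho : ℝ)
    (hlam : 0 ≤ lam) (hmu : 0 ≤ mu) (hrho : 0 < rho)
    (F : (Fin n → ℝ) → ℝ)
    (hF : ∀ u, F u = lam * norm2 u + mu * norm1 u + rho / 2 * ∑ i, (u i - v i) ^ 2)
    (w : Fin n → ℝ)
    (hw : ∀ i, w i = rho * Real.sign (v i) * max (|v i| - mu / rho) 0)
    (ustar : Fin n → ℝ)
    (hustar : ustar = (max (norm2 w - lam) 0 / (rho * norm2 w)) • w) :
    ∀ u : Fin n → ℝ, F ustar ≤ F u := by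
  intro u
  have hN : 0 ≤ norm2 w := Real.sqrt_nonneg _
  have ht : 0 ≤ norm2 u := Real.sqrt_nonneg _
  have hsq : ∀ x : Fin n → ℝ, norm2 x ^ 2 = ∑ i, x i ^ 2 := fun x =>
    Real.sq_sqrt (Finset.sum_nonneg fun i _ => sq_nonneg _)
  have hcs : ∑ i, w i * u i ≤ norm2 w * norm2 u := Real.sum_mul_le_sqrt_mul_sqrt _ _ _
  have key : ∀ i, |rho * v i - w i| ≤ mu ∧ (rho * v i - w i) * w i = mu * |w i| := by
    intro i
    have hm : rho * (mu / rho) = mu := by field_simp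
    have h0 : 0 ≤ mu / rho := by positivity
    rw [hw i]
    rcases lt_trichotomy (v i) 0 with h | h | h
    · rw [Real.sign_of_neg h, abs_of_neg h]
      rcases le_total (-v i - mu / rho) 0 with h1 | h1
      · rw [max_eq_right h1]
        refine ⟨?_, by simp⟩
        rw [abs_le]; constructor <;> nlinarith
      · rw [max_eq_left h1]
        have e : rho * v i - rho * -1 * (-v i - mu / rho) = -mu := by linear_combination -hm
        have e2 : rho * -1 * (-v i - mu / rho) ≤ 0 := by nlinarith
        rw [e, abs_neg, abs_of_nonneg hmu, abs_of_nonpos e2]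
        exact ⟨le_rfl, by ring⟩
    · simp [h, hmu]
    · rw [Real.sign_of_pos h, abs_of_pos h]
      rcases le_total (v i - mu / rho) 0 with h1 | h1
      · rw [max_eq_right h1]
        refine ⟨?_, by simp⟩
        rw [abs_le]; constructor <;> nlinarith
      · rw [max_eq_left h1]
        have e : rho * v i - rho * 1 * (v i - mu / rho) = mu := by linear_combination hm
        have e2 : 0 ≤ rho * 1 * (v i - mu / rho) := by
          rw [mul_one]; exact mul_nonneg hrho.le h1
        rw [e, abs_of_nonneg hmu, abs_of_nonneg e2]
        exact ⟨le_rfl, rfl⟩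
  obtain ⟨c, hc⟩ : ∃ c, c = max (norm2 w - lam) 0 / (rho * norm2 w) := ⟨_, rfl⟩
  have hc0 : 0 ≤ c := by rw [hc]; positivity
  rw [← hc] at hustar
  have hs : rho * (c * norm2 w) = max (norm2 w - lam) 0 := by
    rcases hN.eq_or_lt with h | h
    · rw [← h, max_eq_right (by linarith)]; simp
    · rw [hc]; field_simp
  have hns : norm2 ustar = c * norm2 w := by
    have : norm2 ustar ^ 2 = (c * norm2 w) ^ 2 := by
      rw [hsq, mul_pow, hsq, Finset.mul_sum, hustar]
      simp [mul_pow]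
    exact (sq_eq_sq₀ (Real.sqrt_nonneg _) (by positivity)).1 this
  have hu : ∑ i, (rho / 2 * u i ^ 2 - w i * u i + rho / 2 * v i ^ 2)
      ≤ mu * norm1 u + rho / 2 * ∑ i, (u i - v i) ^ 2 := by
    rw [norm1, Finset.mul_sum, Finset.mul_sum, ← Finset.sum_add_distrib]
    refine Finset.sum_le_sum fun i _ => ?_
    have h1 : (rho * v i - w i) * u i ≤ mu * |u i| := by
      refine (le_abs_self _).trans ?_
      rw [abs_mul]
      exact mul_le_mul_of_nonneg_right (key i).1 (abs_nonneg _)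
    nlinarith
  have hus : mu * norm1 ustar + rho / 2 * ∑ i, (ustar i - v i) ^ 2
      = ∑ i, (rho / 2 * (c ^ 2 * w i ^ 2) - c * w i ^ 2 + rho / 2 * v i ^ 2) := by
    rw [norm1, Finset.mul_sum, Finset.mul_sum, ← Finset.sum_add_distrib]
    refine Finset.sum_congr rfl fun i _ => ?_
    rw [hustar, Pi.smul_apply, smul_eq_mul, abs_mul, abs_of_nonneg hc0]
    linear_combination -c * (key i).2
  rw [Finset.sum_add_distrib, Finset.sum_sub_distrib] at hu hus
  simp only [← Finset.mul_sum, ← hsq] at hu hus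
  rw [hF, hF, hns]
  simp only [← hsq] at *
  generalize norm2 w = N at *
  generalize norm2 u = t at *
  have fin : lam * (c * N) + (rho / 2 * (c ^ 2 * N ^ 2) - c * N ^ 2)
      ≤ lam * t + (rho / 2 * t ^ 2 - N * t) := by
    rcases le_total (N - lam) 0 with h | h
    · rw [max_eq_right h] at hs
      have h2 : c * N = 0 := by
        rcases mul_eq_zero.1 hs with h3 | h3
        · exact absurd h3 hrho.ne'
        · exact h3
      have e : lam * (c * N) + (rho / 2 * (c ^ 2 * N ^ 2) - c * N ^ 2) = 0 := by
        linear_combination (lam + rho / 2 * (c * N) - N) * h2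
      rw [e]
      nlinarith [mul_nonneg ht (sub_nonneg.2 (sub_nonpos.1 h)), mul_nonneg hrho.le (sq_nonneg t)]
    · rw [max_eq_left h] at hs
      have : 0 ≤ rho / 2 * (t - c * N) ^ 2 := by positivity
      have e : lam * t + (rho / 2 * t ^ 2 - N * t)
          - (lam * (c * N) + (rho / 2 * (c ^ 2 * N ^ 2) - c * N ^ 2))
          = rho / 2 * (t - c * N) ^ 2 := by
        linear_combination (t - c * N) * hs
      linarith
  linarith
end

section
/- Let n ≥ 1, let v ∈ ℝⁿ, let λ ≥ 0, μ ≥ 0 and ρ > 0, and define F(u) = λ‖u‖₂ + μ‖u‖₁ + (ρ/2)‖u − v‖₂². Define w ∈ ℝⁿ componentwise by wᵢ = ρ · sgn(vᵢ) · max(|vᵢ| − μ/ρ, 0). If ‖w‖₂ ≤ λ, then 0 is a global minimizer of F over ℝⁿ, i.e., F(0) ≤ F(u) for all u ∈ ℝⁿ. -/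
open Finset

/-- Case 1 in the proof of Lemma 1: if `‖w‖₂ ≤ λ` then `0` is a global
minimizer of `F(u) = λ‖u‖₂ + μ‖u‖₁ + (ρ/2)‖u − v‖₂²`. -/
theorem stmt1 (n : ℕ) (hn : 1 ≤ n) (v : Fin n → ℝ) (lam mu rho : ℝ)
    (hlam : 0 ≤ lam) (hmu : 0 ≤ mu) (hrho : 0 < rho)
    (F : (Fin n → ℝ) → ℝ)
    (hF : ∀ u, F u = lam * norm2 u + mu * norm1 u + rho / 2 * ∑ i, (u i - v i) ^ 2)
    (w : Fin n → ℝ)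
    (hw : ∀ i, w i = rho * Real.sign (v i) * max (|v i| - mu / rho) 0)
    (hsmall : norm2 w ≤ lam) :
    ∀ u : Fin n → ℝ, F 0 ≤ F u := by
  intro u
  have key : ∀ i, rho * v i * u i ≤ w i * u i + mu * |u i| := by
    intro i
    have h1 : |rho * v i - w i| ≤ mu := by
      have hd : rho * (mu / rho) = mu := by field_simp
      rw [hw i, abs_le]
      rcases lt_trichotomy (v i) 0 with h | h | h
      · rw [Real.sign_of_neg h, abs_of_neg h]
        rcases max_cases (-v i - mu / rho) 0 with ⟨h2, h3⟩ | ⟨h2, h3⟩ <;> rw [h2] <;>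
          constructor <;> nlinarith
      · simp [h, hmu]
      · rw [Real.sign_of_pos h, abs_of_pos h]
        rcases max_cases (v i - mu / rho) 0 with ⟨h2, h3⟩ | ⟨h2, h3⟩ <;> rw [h2] <;>
          constructor <;> nlinarith
    have h2 : (rho * v i - w i) * u i ≤ mu * |u i| :=
      (le_abs_self _).trans (by rw [abs_mul]; gcongr)
    linarith
  have hcs : ∑ i, w i * u i ≤ lam * norm2 u :=
    (Real.sum_mul_le_sqrt_mul_sqrt univ w u).trans
      (mul_le_mul_of_nonneg_right hsmall (Real.sqrt_nonneg _))
  have hsum : ∑ i, rho * v i * u i ≤ ∑ i, w i * u i + mu * norm1 u := by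
    rw [norm1, mul_sum, ← sum_add_distrib]
    exact sum_le_sum fun i _ => key i
  have h0 : F 0 = rho / 2 * ∑ i, (v i) ^ 2 := by
    rw [hF]; simp [norm2, norm1]
  have hq : rho / 2 * ∑ i, (v i) ^ 2 - ∑ i, rho * v i * u i
      ≤ rho / 2 * ∑ i, (u i - v i) ^ 2 := by
    rw [mul_sum, mul_sum, ← sum_sub_distrib]
    refine sum_le_sum fun i _ => ?_
    nlinarith [mul_nonneg hrho.le (sq_nonneg (u i))]
  rw [h0, hF u]
  linarith
end

section
/- Let n ≥ 1, let v ∈ ℝⁿ, let λ ≥ 0, μ ≥ 0 and ρ > 0, and define F(u) = λ‖u‖₂ + μ‖u‖₁ + (ρ/2)‖u − v‖₂². Define w ∈ ℝⁿ componentwise by wᵢ = ρ · sgn(vᵢ) · max(|vᵢ| − μ/ρ, 0). If ‖w‖₂ > λ, then u* = ((‖w‖₂ − λ)/(ρ‖w‖₂)) · w is nonzero and is a global minimizer of F over ℝⁿ. -/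
open Finset

theorem aux_z (v mu rho w : ℝ) (hmu : 0 ≤ mu) (hrho : 0 < rho)
    (hw : w = rho * Real.sign v * max (|v| - mu / rho) 0) :
    |rho * v - w| ≤ mu ∧ (rho * v - w) * w = mu * |w| := by
  have hd : rho * (mu / rho) = mu := by field_simp
  have hq : 0 ≤ mu / rho := by positivity
  generalize mu / rho = q at *
  subst hd
  rcases le_total (|v| - q) 0 with h | h
  · rw [max_eq_right h] at hw
    have hw0 : w = 0 := by rw [hw]; ring
    subst hw0
    constructor
    · rw [sub_zero, abs_mul, abs_of_pos hrho]
      exact mul_le_mul_of_nonneg_left (by linarith) hrho.le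
    · simp
  · rw [max_eq_left h] at hw
    rcases lt_trichotomy v 0 with hv | hv | hv
    · rw [Real.sign_of_neg hv, abs_of_neg hv] at hw
      rw [abs_of_neg hv] at h
      have h1 : rho * v - w = -(rho * q) := by rw [hw]; ring
      have h2 : w ≤ 0 := by rw [hw]; nlinarith [mul_nonneg hrho.le h]
      rw [h1, abs_neg, abs_of_nonneg hmu, abs_of_nonpos h2]
      exact ⟨le_rfl, by ring⟩
    · subst hv
      have hw0 : w = 0 := by rw [hw]; simp
      subst hw0
      simpa using hmu
    · rw [Real.sign_of_pos hv, abs_of_pos hv] at hw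
      rw [abs_of_pos hv] at h
      have h1 : rho * v - w = rho * q := by rw [hw]; ring
      have h2 : 0 ≤ w := by rw [hw]; nlinarith [mul_nonneg hrho.le h]
      rw [h1, abs_of_nonneg hmu, abs_of_nonneg h2]
      exact ⟨le_rfl, rfl⟩

/-- Case 2 in the proof of Lemma 1: if `‖w‖₂ > λ` then
`u* = ((‖w‖₂ − λ)/(ρ‖w‖₂)) · w` is nonzero and is a global minimizer of
`F(u) = λ‖u‖₂ + μ‖u‖₁ + (ρ/2)‖u − v‖₂²`. -/
theorem stmt2 (n : ℕ) (hn : 1 ≤ n) (v : Fin n → ℝ) (lam mu rho : ℝ)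
    (hlam : 0 ≤ lam) (hmu : 0 ≤ mu) (hrho : 0 < rho)
    (F : (Fin n → ℝ) → ℝ)
    (hF : ∀ u, F u = lam * norm2 u + mu * norm1 u + rho / 2 * ∑ i, (u i - v i) ^ 2)
    (w : Fin n → ℝ)
    (hw : ∀ i, w i = rho * Real.sign (v i) * max (|v i| - mu / rho) 0)
    (hbig : lam < norm2 w)
    (ustar : Fin n → ℝ)
    (hustar : ustar = ((norm2 w - lam) / (rho * norm2 w)) • w) :
    ustar ≠ 0 ∧ ∀ u : Fin n → ℝ, F ustar ≤ F u := by
  have hN : 0 < norm2 w := lt_of_le_of_lt hlam hbig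
  have hNsq : ∑ i, (w i) ^ 2 = norm2 w ^ 2 := by
    unfold norm2
    rw [Real.sq_sqrt (Finset.sum_nonneg fun i _ => sq_nonneg _)]
  have hc : 0 < (norm2 w - lam) / (rho * norm2 w) := div_pos (by linarith) (by positivity)
  have hcs : ∀ c : ℝ, 0 < c → norm2 (c • w) = c * norm2 w := by
    intro c hc
    unfold norm2
    have : ∑ i, ((c • w) i) ^ 2 = c ^ 2 * ∑ i, (w i) ^ 2 := by
      rw [Finset.mul_sum]
      exact Finset.sum_congr rfl fun i _ => by simp [mul_pow]
    rw [this, Real.sqrt_mul (sq_nonneg c), Real.sqrt_sq hc.le]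
  have hceq : rho * ((norm2 w - lam) / (rho * norm2 w)) = 1 - lam / norm2 w := by
    field_simp
  generalize (norm2 w - lam) / (rho * norm2 w) = c at *
  have hus := hcs c hc
  subst hustar
  constructor
  · intro h0
    rw [h0] at hus
    have : norm2 (0 : Fin n → ℝ) = 0 := by simp [norm2]
    rw [this] at hus
    have := mul_pos hc hN
    linarith
  intro u
  have hCS : ∑ i, w i * u i ≤ norm2 w * norm2 u :=
    Real.sum_mul_le_sqrt_mul_sqrt _ _ _
  have h1 : lam / norm2 w * ∑ i, w i * u i ≤ lam * norm2 u := by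
    calc _ ≤ lam / norm2 w * (norm2 w * norm2 u) :=
          mul_le_mul_of_nonneg_left hCS (by positivity)
      _ = _ := by field_simp
  have h2 : lam * (c * norm2 w) = lam / norm2 w * ∑ i, w i * (c * w i) := by
    have : ∑ i, w i * (c * w i) = c * norm2 w ^ 2 := by
      rw [← hNsq, Finset.mul_sum]
      exact Finset.sum_congr rfl fun i _ => by ring
    rw [this]
    field_simp
  have h3 : ∑ i, (lam / norm2 w * (w i * (c * w i)) + mu * |c * w i|
        + rho / 2 * (c * w i - v i) ^ 2)
      ≤ ∑ i, (lam / norm2 w * (w i * u i) + mu * |u i| + rho / 2 * (u i - v i) ^ 2) := by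
    refine Finset.sum_le_sum fun i _ => ?_
    obtain ⟨ha, hb⟩ := aux_z (v i) mu rho (w i) hmu hrho (hw i)
    have hz : (rho * v i - w i) * u i ≤ mu * |u i| := by
      calc _ ≤ |(rho * v i - w i) * u i| := le_abs_self _
        _ = |rho * v i - w i| * |u i| := abs_mul _ _
        _ ≤ _ := mul_le_mul_of_nonneg_right ha (abs_nonneg _)
    rw [abs_mul, abs_of_pos hc]
    have hl : lam / norm2 w = 1 - rho * c := by linarith
    rw [hl]
    have hsq : 0 ≤ rho / 2 * (u i - c * w i) ^ 2 := by positivity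
    have hb' : mu * (c * |w i|) = c * ((rho * v i - w i) * w i) := by rw [hb]; ring
    rw [hb']
    linarith
  simp only [Finset.sum_add_distrib, ← Finset.mul_sum] at h3
  rw [hF, hF, hus, h2]
  simp only [norm1, Pi.smul_apply, smul_eq_mul]
  linarith
end

section
/- Let ρ > 0 and let R ∈ ℝ^{n×s}, B ∈ ℝ^{d×m}, Y ∈ ℝ^{m×s}, C ∈ ℝ^{n×d}, U ∈ ℝ^{n×d} be real matrices. Define f(A) = (1/2)‖R − A·B·Y‖_F² + tr(Cᵀ·A) + (ρ/2)‖A − U‖_F² for A ∈ ℝ^{n×d}. Then A* = (R·Yᵀ·Bᵀ − C + ρ·U)·(B·Y·Yᵀ·Bᵀ + ρ·I)⁻¹ is the unique global minimizer of f, i.e., f(A*) ≤ f(A) for all A ∈ ℝ^{n×d}, with equality only at A = A*. -/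
open Matrix

/-- Squared Frobenius norm of a matrix: `‖M‖_F² = ∑ᵢⱼ Mᵢⱼ² = tr(MᵀM)`. -/
def frobSq {n m : ℕ} (M : Matrix (Fin n) (Fin m) ℝ) : ℝ := ∑ i, ∑ j, (M i j) ^ 2

theorem frobSq_add' {n m : ℕ} (P Q : Matrix (Fin n) (Fin m) ℝ) :
    frobSq (P + Q) = frobSq P + 2 * (Q * Pᵀ).trace + frobSq Q := by
  simp only [frobSq, Matrix.trace, Matrix.diag, Matrix.mul_apply, Matrix.transpose_apply,
    Matrix.add_apply, Finset.mul_sum, ← Finset.sum_add_distrib]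
  refine Finset.sum_congr rfl fun i _ => Finset.sum_congr rfl fun j _ => ?_
  ring

theorem frobSq_nonneg' {n m : ℕ} (P : Matrix (Fin n) (Fin m) ℝ) : 0 ≤ frobSq P :=
  Finset.sum_nonneg fun _ _ => Finset.sum_nonneg fun _ _ => sq_nonneg _

theorem frobSq_neg' {n m : ℕ} (P : Matrix (Fin n) (Fin m) ℝ) : frobSq (-P) = frobSq P := by
  simp [frobSq]

theorem frobSq_eq_zero' {n m : ℕ} (P : Matrix (Fin n) (Fin m) ℝ) (h : frobSq P = 0) : P = 0 := by
  ext i j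
  have h0 := (Finset.sum_eq_zero_iff_of_nonneg (s := Finset.univ) (f := fun i => ∑ j, (P i j) ^ 2)
    (fun _ _ => Finset.sum_nonneg fun _ _ => sq_nonneg _)).1 h i (Finset.mem_univ _)
  have h1 := (Finset.sum_eq_zero_iff_of_nonneg (s := Finset.univ) (f := fun j => (P i j) ^ 2)
    (fun _ _ => sq_nonneg _)).1 h0
  simpa using h1 j (Finset.mem_univ _)

/-- The closed-form `A`-update in the ADMM algorithm:
`A* = (R·Yᵀ·Bᵀ − C + ρ·U)·(B·Y·Yᵀ·Bᵀ + ρ·I)⁻¹` is the unique global minimizer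
of `f(A) = (1/2)‖R − A·B·Y‖_F² + tr(Cᵀ·A) + (ρ/2)‖A − U‖_F²`. -/
theorem stmt8 (n d m s : ℕ) (rho : ℝ) (hrho : 0 < rho)
    (R : Matrix (Fin n) (Fin s) ℝ) (B : Matrix (Fin d) (Fin m) ℝ)
    (Y : Matrix (Fin m) (Fin s) ℝ) (C U : Matrix (Fin n) (Fin d) ℝ)
    (f : Matrix (Fin n) (Fin d) ℝ → ℝ)
    (hf : ∀ A, f A = (1 / 2) * frobSq (R - A * B * Y) + (Cᵀ * A).trace
        + (rho / 2) * frobSq (A - U))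
    (Astar : Matrix (Fin n) (Fin d) ℝ)
    (hAstar : Astar = (R * Yᵀ * Bᵀ - C + rho • U)
        * (B * Y * Yᵀ * Bᵀ + rho • (1 : Matrix (Fin d) (Fin d) ℝ))⁻¹) :
    ∀ A : Matrix (Fin n) (Fin d) ℝ, f Astar ≤ f A ∧ (f A = f Astar → A = Astar) := by
  have hpd : (B * Y * Yᵀ * Bᵀ + rho • (1 : Matrix (Fin d) (Fin d) ℝ)).PosDef := by
    have h1 : (B * Y * Yᵀ * Bᵀ).PosSemidef := by
      have := Matrix.posSemidef_self_mul_conjTranspose (B * Y)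
      simpa [Matrix.conjTranspose_eq_transpose_of_trivial, Matrix.transpose_mul,
        Matrix.mul_assoc] using this
    exact Matrix.PosDef.posSemidef_add h1 (Matrix.PosDef.one.smul hrho)
  have hu : IsUnit (B * Y * Yᵀ * Bᵀ + rho • (1 : Matrix (Fin d) (Fin d) ℝ)).det :=
    (Matrix.isUnit_iff_isUnit_det _).1 hpd.isUnit
  have hG : Astar * (B * Y * Yᵀ * Bᵀ + rho • (1 : Matrix (Fin d) (Fin d) ℝ))
      = R * Yᵀ * Bᵀ - C + rho • U := by
    rw [hAstar, Matrix.mul_assoc, Matrix.nonsing_inv_mul _ hu, Matrix.mul_one]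
  have key : ∀ D, f (Astar + D) = f Astar + (1 / 2) * frobSq (D * B * Y)
      + (rho / 2) * frobSq D := by
    intro D
    have e1 : R - (Astar + D) * B * Y = (R - Astar * B * Y) + -(D * B * Y) := by
      rw [Matrix.add_mul, Matrix.add_mul]; abel
    have e2 : Astar + D - U = (Astar - U) + D := by abel
    have hC : C = R * Yᵀ * Bᵀ + rho • U
        - Astar * (B * Y * Yᵀ * Bᵀ + rho • (1 : Matrix (Fin d) (Fin d) ℝ)) := by
      rw [hG]; abel
    have e3 : (Cᵀ * D).trace = (D * B * Y * (R - Astar * B * Y)ᵀ).trace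
        - rho * (D * (Astar - U)ᵀ).trace := by
      rw [Matrix.trace_mul_comm, hC]
      simp only [Matrix.transpose_sub, Matrix.transpose_add, Matrix.transpose_mul,
        Matrix.transpose_smul, Matrix.transpose_transpose, Matrix.mul_sub, Matrix.mul_add,
        Matrix.add_mul, Matrix.transpose_one, Matrix.smul_mul, Matrix.mul_smul, Matrix.one_mul,
        Matrix.mul_assoc, Matrix.trace_sub, Matrix.trace_add, Matrix.trace_smul, smul_eq_mul]
      ring
    rw [hf, hf, e1, e2, frobSq_add', frobSq_add', frobSq_neg', Matrix.mul_add, Matrix.trace_add,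
      e3, Matrix.neg_mul, Matrix.trace_neg]
    ring
  intro A
  have hk := key (A - Astar)
  rw [add_sub_cancel] at hk
  have n1 := frobSq_nonneg' ((A - Astar) * B * Y)
  have n2 := frobSq_nonneg' (A - Astar)
  have n3 := mul_nonneg hrho.le n2
  refine ⟨by linarith, fun h => ?_⟩
  have h0 : rho * frobSq (A - Astar) = 0 := by linarith
  exact sub_eq_zero.1 (frobSq_eq_zero' _ ((mul_eq_zero.1 h0).resolve_left hrho.ne'))
end

section
/- Let H ∈ ℝ^{n×n}, S ∈ ℝ^{n×n}, F ∈ ℝ^{n×n}, and suppose Y ∈ ℝ^{n×n} satisfies H·Y·Sᵀ + Y = F. Fix an index k and suppose S_{k,j} = 0 for all j < k. Then the k-th column y_k of Y satisfies the linear system (S_{k,k}·H + I)·y_k = f_k − H·Σ_{j=k+1}^{n} S_{k,j}·y_j, where f_k is the k-th column of F and y_j is the j-th column of Y. -/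
open Matrix Finset

/-- Case (a) of the back-substitution step in the Hessenberg–Schur method:
if `H·Y·Sᵀ + Y = F` and row `k` of `S` vanishes strictly below the diagonal,
then the `k`-th column `y_k` of `Y` satisfies
`(S_{kk}·H + I)·y_k = f_k − H·Σ_{j>k} S_{kj}·y_j`. -/
theorem stmt13 (n : ℕ) (H S F Y : Matrix (Fin n) (Fin n) ℝ)
    (hY : H * Y * Sᵀ + Y = F)
    (k : Fin n) (hS : ∀ j : Fin n, j < k → S k j = 0) :
    (S k k • H + (1 : Matrix (Fin n) (Fin n) ℝ)).mulVec (fun i => Y i k)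
      = (fun i => F i k)
        - H.mulVec (∑ j ∈ Finset.univ.filter (fun j => k < j),
            S k j • (fun i => Y i j)) := by
  have h1 : (fun i => (Y * Sᵀ) i k) = S k k • (fun i => Y i k)
      + ∑ j ∈ Finset.univ.filter (fun j => k < j), S k j • (fun i => Y i j) := by
    funext i
    simp only [Matrix.mul_apply, Matrix.transpose_apply, Pi.add_apply, Pi.smul_apply,
      Finset.sum_apply, smul_eq_mul]
    rw [Finset.sum_filter, ← Finset.add_sum_erase _ _ (Finset.mem_univ k),
      ← Finset.add_sum_erase (a := k) _ (fun j => if k < j then S k j * Y i j else 0)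
        (Finset.mem_univ k)]
    simp only [lt_irrefl, if_false, zero_add]
    rw [mul_comm (Y i k)]
    congr 1
    refine Finset.sum_congr rfl fun j hj => ?_
    have hjk := Finset.ne_of_mem_erase hj
    split_ifs with h
    · exact mul_comm _ _
    · rw [hS j (lt_of_le_of_ne (not_lt.mp h) hjk), mul_zero]
  have h2 : (fun i => F i k) = H.mulVec (fun i => (Y * Sᵀ) i k) + (fun i => Y i k) := by
    funext i
    rw [← hY, Matrix.mul_assoc]
    rfl
  rw [h2, h1, Matrix.mulVec_add, Matrix.add_mulVec, Matrix.one_mulVec, Matrix.smul_mulVec,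
    Matrix.mulVec_smul]
  abel
end

section
/- Let H ∈ ℝ^{n×n}, S ∈ ℝ^{n×n}, F ∈ ℝ^{n×n}, and suppose Y ∈ ℝ^{n×n} satisfies H·Y·Sᵀ + Y = F. Fix an index k ≥ 2 and suppose S_{k−1,j} = 0 and S_{k,j} = 0 for all j < k−1. Then the columns y_{k−1} and y_k of Y satisfy the 2n×2n block linear system [[S_{k−1,k−1}·H + I, S_{k−1,k}·H], [S_{k,k−1}·H, S_{k,k}·H + I]] · [y_{k−1}; y_k] = [f_{k−1}; f_k] − Σ_{j=k+1}^{n} [S_{k−1,j}·H·y_j; S_{k,j}·H·y_j], where f_j denotes the j-th column of F. -/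
open Matrix Finset

theorem stmt14_aux (n : ℕ) (k₁ k₂ : Fin n) (hk : (k₁ : ℕ) + 1 = (k₂ : ℕ))
    (s g : Fin n → ℝ) (hs : ∀ j : Fin n, j < k₁ → s j = 0) :
    ∑ j, g j * s j = s k₁ * g k₁ + s k₂ * g k₂
      + ∑ j ∈ Finset.univ.filter (fun j => k₂ < j), s j * g j := by
  have hne : k₁ ≠ k₂ := by
    intro h
    rw [h] at hk
    omega
  have h1 : ∀ j, g j * s j = (if j = k₁ then s j * g j else 0)
      + (if j = k₂ then s j * g j else 0) + (if k₂ < j then s j * g j else 0) := by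
    intro j
    rcases lt_trichotomy j k₁ with h | h | h
    · simp [hs j h]
    · subst h
      have h2 : ¬ k₂ < j := by rw [Fin.lt_def]; omega
      simp [hne, h2, mul_comm]
    · by_cases h3 : j = k₂
      · subst h3
        simp [hne.symm, mul_comm]
      · have h2 : k₂ < j := by
          rw [Fin.lt_def] at *
          have : (j : ℕ) ≠ k₂ := fun e => h3 (Fin.ext e)
          omega
        simp [h.ne', h3, h2, mul_comm]
  rw [Finset.sum_congr rfl (fun j _ => h1 j), Finset.sum_add_distrib, Finset.sum_add_distrib,
    Finset.sum_filter]
  simp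

/-- Case (b) of the back-substitution step in the Hessenberg–Schur method:
if `H·Y·Sᵀ + Y = F` and rows `k−1` and `k` of `S` vanish strictly to the left
of column `k−1`, then the columns `y_{k−1}` and `y_k` of `Y` satisfy the
`2n×2n` block linear system
`[[S_{k−1,k−1}·H + I, S_{k−1,k}·H], [S_{k,k−1}·H, S_{k,k}·H + I]]·[y_{k−1}; y_k]
  = [f_{k−1}; f_k] − Σ_{j>k} [S_{k−1,j}·H·y_j; S_{k,j}·H·y_j]`.
Here `k₁` plays the role of `k−1` and `k₂` the role of `k`. -/
theorem stmt14 (n : ℕ) (H S F Y : Matrix (Fin n) (Fin n) ℝ)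
    (hY : H * Y * Sᵀ + Y = F)
    (k₁ k₂ : Fin n) (hk : (k₁ : ℕ) + 1 = (k₂ : ℕ))
    (hS : ∀ j : Fin n, j < k₁ → S k₁ j = 0 ∧ S k₂ j = 0) :
    (Matrix.fromBlocks
        (S k₁ k₁ • H + (1 : Matrix (Fin n) (Fin n) ℝ)) (S k₁ k₂ • H)
        (S k₂ k₁ • H) (S k₂ k₂ • H + (1 : Matrix (Fin n) (Fin n) ℝ))).mulVec
      (Sum.elim (fun i => Y i k₁) (fun i => Y i k₂))
      = Sum.elim
          ((fun i => F i k₁)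
            - ∑ j ∈ Finset.univ.filter (fun j => k₂ < j),
                S k₁ j • H.mulVec (fun i => Y i j))
          ((fun i => F i k₂)
            - ∑ j ∈ Finset.univ.filter (fun j => k₂ < j),
                S k₂ j • H.mulVec (fun i => Y i j)) := by
  have key : ∀ k : Fin n, (∀ j, j < k₁ → S k j = 0) → ∀ i,
      F i k = S k k₁ * H.mulVec (fun i => Y i k₁) i + S k k₂ * H.mulVec (fun i => Y i k₂) i
        + ∑ j ∈ Finset.univ.filter (fun j => k₂ < j), S k j * H.mulVec (fun i => Y i j) i
        + Y i k := by
    intro k h i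
    rw [← stmt14_aux n k₁ k₂ hk (S k) (fun j => H.mulVec (fun i => Y i j) i) h, ← hY]
    rfl
  rw [Matrix.fromBlocks_mulVec]
  funext x
  rcases x with i | i
  · have := key k₁ (fun j hj => (hS j hj).1) i
    simp [Matrix.add_mulVec, Matrix.smul_mulVec, Finset.sum_apply, Function.comp_def]
    linarith
  · have := key k₂ (fun j hj => (hS j hj).2) i
    simp [Matrix.add_mulVec, Matrix.smul_mulVec, Finset.sum_apply, Function.comp_def]
    linarith
end

section
/- Let v ∈ ℝⁿ, λ > 0, μ > 0, ρ > 0, and define w ∈ ℝⁿ by wᵢ = ρ·sgn(vᵢ)·max(|vᵢ| − μ/ρ, 0). Suppose ‖w‖₂ ≤ λ. Define t ∈ ℝⁿ by tᵢ = (ρ/μ)·vᵢ if |vᵢ| ≤ μ/ρ and tᵢ = sgn(vᵢ) otherwise, and define s = (ρ·v − μ·t)/λ. Then ‖s‖₂ = ‖w‖₂/λ ≤ 1 and λ·s + μ·t = ρ·v; i.e., there exist vectors s with ‖s‖₂ ≤ 1 and t with all |tᵢ| ≤ 1 satisfying λ·s + μ·t = ρ·v. -/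
open Finset

/-- The explicit subgradient certificate in Case 1 of the proof of Lemma 1:
with `t` as defined and `s = (ρ·v − μ·t)/λ` one has `‖s‖₂ = ‖w‖₂/λ ≤ 1`,
`|tᵢ| ≤ 1` for all `i`, and `λ·s + μ·t = ρ·v`. -/
theorem stmt17 (n : ℕ) (v : Fin n → ℝ) (lam mu rho : ℝ)
    (hlam : 0 < lam) (hmu : 0 < mu) (hrho : 0 < rho)
    (w : Fin n → ℝ)
    (hw : ∀ i, w i = rho * Real.sign (v i) * max (|v i| - mu / rho) 0)
    (hsmall : norm2 w ≤ lam)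
    (t : Fin n → ℝ)
    (ht : ∀ i, t i = if |v i| ≤ mu / rho then (rho / mu) * v i else Real.sign (v i))
    (s : Fin n → ℝ)
    (hs : ∀ i, s i = (rho * v i - mu * t i) / lam) :
    norm2 s = norm2 w / lam ∧ norm2 s ≤ 1 ∧ (∀ i, |t i| ≤ 1) ∧
      ∀ i, lam * s i + mu * t i = rho * v i := by
  have hsw : ∀ i, s i = w i / lam := by
    intro i
    rw [hs i, hw i, ht i]
    congr 1
    split_ifs with h
    · rw [max_eq_right (by linarith)]
      field_simp
      ring
    · push Not at h
      rw [max_eq_left (by linarith)]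
      have hp : 0 < mu / rho := by positivity
      rcases lt_trichotomy (v i) 0 with h0 | h0 | h0
      · rw [Real.sign_of_neg h0, abs_of_neg h0]
        field_simp
        ring
      · rw [h0, abs_zero] at h
        linarith
      · rw [Real.sign_of_pos h0, abs_of_pos h0]
        field_simp
  have hn : norm2 s = norm2 w / lam := by
    unfold norm2
    simp_rw [hsw, div_pow]
    rw [← Finset.sum_div, Real.sqrt_div' _ (by positivity), Real.sqrt_sq hlam.le]
  refine ⟨hn, ?_, ?_, ?_⟩
  · rw [hn, div_le_one hlam]
    exact hsmall
  · intro i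
    rw [ht i]
    split_ifs with h
    · rw [abs_mul, abs_of_pos (by positivity : 0 < rho / mu)]
      rw [le_div_iff₀ hrho] at h
      rw [div_mul_eq_mul_div, div_le_one hmu]
      linarith
    · rcases Real.sign_apply_eq (v i) with h | h | h <;> rw [h] <;> simp
  · intro i
    rw [hs i]
    field_simp
    ring
end
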